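/- For every t ≥ 2, if k = 2t + r with 0 ≤ r ≤ 2t - 3, then there exists an isolation set of size 2r + 3 = 2k - 4t + 3 in A_{k,t}. -/

import Mathlib

/-- An isolation set of size `n` in `A_{k,t}`: sequences `x` and `y` of
`t`-element subsets of `{1,…,k}` with `x i ∩ y i ≠ ∅` for all `i`, and for
`i ≠ j`, `x i ∩ y j = ∅` or `x j ∩ y i = ∅`. -/
def IsIsolationSet (k t n : ℕ) (x y : Fin n → Finset ℕ) : Prop :=
  (∀ i, x i ⊆ Finset.Icc 1 k ∧ (x i).card = t) ∧
  (∀ i, y i ⊆ Finset.Icc 1 k ∧ (y i).card = t) ∧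
  (∀ i, (x i ∩ y i).Nonempty) ∧
  (∀ i j, i ≠ j → x i ∩ y j = ∅ ∨ x j ∩ y i = ∅)

/-- The set `{1 + ((a + s) mod n) : s < p}` for `a, p ≤ n`, a cyclic interval in `{1,…,n}`. -/
def cyclicInterval (n a p : ℕ) : Finset ℕ :=
  (Finset.range p).image fun s => if a + s < n then a + s + 1 else a + s + 1 - n

lemma mem_cyclicInterval {n a p c : ℕ} :
    c ∈ cyclicInterval n a p ↔
      ∃ s < p, (if a + s < n then a + s + 1 else a + s + 1 - n) = c := by
  simp [cyclicInterval]

lemma card_cyclicInterval {n a p : ℕ} (hp : p ≤ n) :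
    (cyclicInterval n a p).card = p := by
  rw [cyclicInterval, Finset.card_image_of_injOn, Finset.card_range]
  intro s hs u hu h
  simp only [Finset.coe_range, Set.mem_Iio] at hs hu
  dsimp only at h
  split_ifs at h <;> omega

lemma cyclicInterval_subset {n a p : ℕ} (ha : a ≤ n) (hp : p ≤ n) :
    cyclicInterval n a p ⊆ Finset.Icc 1 n := by
  intro c hc
  obtain ⟨s, hs, rfl⟩ := mem_cyclicInterval.1 hc
  rw [Finset.mem_Icc]
  split_ifs <;> omega

lemma card_cyclicInterval_union_Icc {n a p b e : ℕ} (ha : a ≤ n) (hp : p ≤ n) (hb : n < b) :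
    (cyclicInterval n a p ∪ Finset.Icc b e).card = p + (e + 1 - b) := by
  rw [Finset.card_union_of_disjoint, card_cyclicInterval hp, Nat.card_Icc]
  rw [Finset.disjoint_left]
  intro c hc hc'
  have := Finset.mem_Icc.1 (cyclicInterval_subset ha hp hc)
  have := Finset.mem_Icc.1 hc'
  omega

lemma cyclicInterval_union_Icc_subset {n a p b e k : ℕ} (ha : a ≤ n) (hp : p ≤ n) (hb : n < b)
    (hn : n ≤ k) (he : e ≤ k) :
    cyclicInterval n a p ∪ Finset.Icc b e ⊆ Finset.Icc 1 k :=
  Finset.union_subset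
    ((cyclicInterval_subset ha hp).trans (Finset.Icc_subset_Icc_right hn))
    (Finset.Icc_subset_Icc (by omega) he)

/-- A cyclic interval of length `q` ending at `i` meets one of length `p` starting at `j` only if
`i - j` is congruent modulo `n` to one of `0, …, p + q - 2`. -/
lemma sub_le_of_inter_nonempty {n p q i j b m e : ℕ} (hp : p ≤ n) (hq : q ≤ n)
    (hi : i < n) (hj : j < n) (hb : n < b)
    (h : ((cyclicInterval n (if i + 1 < q then i + 1 + n - q else i + 1 - q) q ∪
        Finset.Icc (m + 1) e) ∩ (cyclicInterval n j p ∪ Finset.Icc b m)).Nonempty)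
    (hm : n ≤ m) :
    (j ≤ i ∧ i + 2 ≤ j + (p + q)) ∨ i + n + 2 ≤ j + (p + q) := by
  obtain ⟨c, hc⟩ := h
  have ha : (if i + 1 < q then i + 1 + n - q else i + 1 - q) ≤ n := by split_ifs <;> omega
  simp only [Finset.mem_inter, Finset.mem_union] at hc
  obtain ⟨hx | hx, hy | hy⟩ := hc
  · obtain ⟨s, hs, rfl⟩ := mem_cyclicInterval.1 hx
    obtain ⟨u, hu, h⟩ := mem_cyclicInterval.1 hy
    split_ifs at h <;> omega
  · have := Finset.mem_Icc.1 (cyclicInterval_subset ha hq hx)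
    have := Finset.mem_Icc.1 hy
    omega
  · have := Finset.mem_Icc.1 (cyclicInterval_subset hj.le hp hy)
    have := Finset.mem_Icc.1 hx
    omega
  · have := Finset.mem_Icc.1 hx
    have := Finset.mem_Icc.1 hy
    omega

/-- for every `t ≥ 2`, if `k = 2t + r` with `0 ≤ r ≤ 2t - 3`,
then there is an isolation set of size `2r + 3 = 2k - 4t + 3` in `A_{k,t}`. -/
theorem isolation_set_middle_range (t r k : ℕ) (ht : 2 ≤ t)
    (hr : r ≤ 2 * t - 3) (hk : k = 2 * t + r) :
    ∃ x y : Fin (2 * r + 3) → Finset ℕ, IsIsolationSet k t (2 * r + 3) x y := by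
  obtain ⟨p, q, hpq, hp, hq, hpt, hqt⟩ :
      ∃ p q, p + q = r + 3 ∧ 0 < p ∧ 0 < q ∧ p ≤ t ∧ q ≤ t :=
    ⟨(r + 3) / 2, r + 3 - (r + 3) / 2, by omega, by omega, by omega, by omega, by omega⟩
  obtain ⟨n, hn⟩ : ∃ n, n = 2 * r + 3 := ⟨_, rfl⟩
  rw [← hn]
  have ha (i : Fin n) :
      (if (i : ℕ) + 1 < q then (i : ℕ) + 1 + n - q else (i : ℕ) + 1 - q) ≤ n := by
    have := i.2
    split_ifs <;> omega
  refine ⟨fun i => cyclicInterval n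
      (if (i : ℕ) + 1 < q then (i : ℕ) + 1 + n - q else (i : ℕ) + 1 - q) q ∪
        Finset.Icc (n + (t - p) + 1) k,
    fun j => cyclicInterval n j p ∪ Finset.Icc (n + 1) (n + (t - p)), ?_, ?_, ?_, ?_⟩
  · refine fun i => ⟨cyclicInterval_union_Icc_subset (ha i) ?_ ?_ ?_ ?_, ?_⟩
    · omega
    · omega
    · omega
    · omega
    · rw [card_cyclicInterval_union_Icc (ha i) (by omega) (by omega)]
      omega
  · refine fun j => ⟨cyclicInterval_union_Icc_subset j.2.le ?_ ?_ ?_ ?_, ?_⟩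
    · omega
    · omega
    · omega
    · omega
    · rw [card_cyclicInterval_union_Icc j.2.le (by omega) (by omega)]
      omega
  · intro i
    have := i.2
    refine ⟨i + 1, Finset.mem_inter.2 ⟨Finset.mem_union_left _ ?_, Finset.mem_union_left _ ?_⟩⟩
    · refine mem_cyclicInterval.2 ⟨q - 1, by omega, ?_⟩
      split_ifs <;> omega
    · refine mem_cyclicInterval.2 ⟨0, hp, ?_⟩
      split_ifs <;> omega
  · intro i j hij
    have hne : (i : ℕ) ≠ j := fun h => hij (Fin.ext h)
    by_contra! h
    have h₁ := sub_le_of_inter_nonempty (by omega) (by omega) i.2 j.2 (by omega) h.1 (by omega)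
    have h₂ := sub_le_of_inter_nonempty (by omega) (by omega) j.2 i.2 (by omega) h.2 (by omega)
    omega
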